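/- arXiv:2605.26698 — 2 statements merged into one kernel-verified Lean document; each statement's English description precedes it below -/
import Mathlib

section
/- Soundness of the R-Invariant rule: let A1 = (S1, step1, F1) and A2 = (S2, step2, F2) be Büchi automata over the same event type E, and let G(H) := gfp (fun X => fsimLdelayF (X ⊔ H)). Let H, H' be relations with (s1, s2) ∈ H', H' contained in F1 × S2 (i.e., H' s1' s2' implies s1' ∈ F1), and suppose that for all (s1', s2') ∈ H' we have (s1', s2') ∈ fsimR_delay((H ⊔ H') ⊔ G(H ⊔ H')). Then (s1, s2) ∈ fsimR_delay(H ⊔ G(H)). -/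
namespace AFS

/-- Greatest fixed point (Knaster–Tarski): for a monotone `f`, this is the
greatest fixed point of `f`. -/
def gfp {α : Type*} [CompleteLattice α] (f : α → α) : α := sSup {a | a ≤ f a}

/-- Least fixed point (Knaster–Tarski): for a monotone `f`, this is the
least fixed point of `f`. -/
def lfp {α : Type*} [CompleteLattice α] (f : α → α) : α := sInf {a | f a ≤ a}

variable {E S S1 S2 : Type*}

/-- `ρ` is a run of the transition relation `step` from state `s` over the infinite word `τ`. -/
def IsRun (step : S → E → S → Prop) (s : S) (τ : ℕ → E) (ρ : ℕ → S) : Prop :=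
  ρ 0 = s ∧ ∀ n, step (ρ n) (τ n) (ρ (n + 1))

/-- Büchi language of a state: words admitting a run visiting `F` infinitely often. -/
def Lang (step : S → E → S → Prop) (F : Set S) (s : S) : Set (ℕ → E) :=
  {τ | ∃ ρ, IsRun step s τ ρ ∧ {n | ρ n ∈ F}.Infinite}

/-- Traces of a state: words admitting a run (no acceptance requirement). -/
def Traces (step : S → E → S → Prop) (s : S) : Set (ℕ → E) :=
  {τ | ∃ ρ, IsRun step s τ ρ}

/-- One-step matching operator on relations. -/
def Match (step1 : S1 → E → S1 → Prop) (step2 : S2 → E → S2 → Prop)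
    (X : S1 → S2 → Prop) : S1 → S2 → Prop :=
  fun s1 s2 => ∀ e s1', step1 s1 e s1' → ∃ s2', step2 s2 e s2' ∧ X s1' s2'

/-- Inductive part of delay simulation: reach a right-accepting state, then pass to `X`. -/
def fsimRdelay (step1 : S1 → E → S1 → Prop) (step2 : S2 → E → S2 → Prop)
    (F2 : Set S2) (X : S1 → S2 → Prop) : S1 → S2 → Prop :=
  lfp (fun Y =>
    (fun s1 s2 => s2 ∈ F2 ∧ Match step1 step2 X s1 s2) ⊔ Match step1 step2 Y)

/-- Functor underlying delay simulation. -/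
def fsimLdelayF (step1 : S1 → E → S1 → Prop) (F1 : Set S1)
    (step2 : S2 → E → S2 → Prop) (F2 : Set S2)
    (X : S1 → S2 → Prop) : S1 → S2 → Prop :=
  fsimRdelay step1 step2 F2 X ⊔ (fun s1 s2 => s1 ∉ F1 ∧ Match step1 step2 X s1 s2)

/-- Delay simulation. -/
def fsimLdelay (step1 : S1 → E → S1 → Prop) (F1 : Set S1)
    (step2 : S2 → E → S2 → Prop) (F2 : Set S2) : S1 → S2 → Prop :=
  gfp (fsimLdelayF step1 F1 step2 F2)

/-- Parameterized greatest fixed point of the delay simulation functor. -/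
def pG (step1 : S1 → E → S1 → Prop) (F1 : Set S1)
    (step2 : S2 → E → S2 → Prop) (F2 : Set S2)
    (H : S1 → S2 → Prop) : S1 → S2 → Prop :=
  gfp (fun X => fsimLdelayF step1 F1 step2 F2 (X ⊔ H))

theorem Match_mono (step1 : S1 → E → S1 → Prop) (step2 : S2 → E → S2 → Prop) :
    Monotone (Match step1 step2) := by
  intro X Y hXY s1 s2 h e s1' hs
  obtain ⟨s2', hs2, hX⟩ := h e s1' hs
  exact ⟨s2', hs2, hXY _ _ hX⟩

theorem fsimRdelay_mono (step1 : S1 → E → S1 → Prop) (step2 : S2 → E → S2 → Prop)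
    (F2 : Set S2) : Monotone (fsimRdelay step1 step2 F2) := by
  intro X Y hXY
  refine sInf_le_sInf fun Z hZ => ?_
  rw [Set.mem_ofPred_eq] at hZ ⊢
  refine le_trans (sup_le_sup_right ?_ _) hZ
  exact fun s1 s2 h => ⟨h.1, Match_mono step1 step2 hXY _ _ h.2⟩

theorem fsimLdelayF_mono (step1 : S1 → E → S1 → Prop) (F1 : Set S1)
    (step2 : S2 → E → S2 → Prop) (F2 : Set S2) :
    Monotone (fsimLdelayF step1 F1 step2 F2) := by
  intro X Y hXY
  refine sup_le_sup (fsimRdelay_mono step1 step2 F2 hXY) ?_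
  exact fun s1 s2 h => ⟨h.1, Match_mono step1 step2 hXY _ _ h.2⟩

theorem le_pG {step1 : S1 → E → S1 → Prop} {F1 : Set S1}
    {step2 : S2 → E → S2 → Prop} {F2 : Set S2} {H X : S1 → S2 → Prop}
    (h : X ≤ fsimLdelayF step1 F1 step2 F2 (X ⊔ H)) : X ≤ pG step1 F1 step2 F2 H :=
  le_sSup h

theorem pG_le_fsimLdelayF (step1 : S1 → E → S1 → Prop) (F1 : Set S1)
    (step2 : S2 → E → S2 → Prop) (F2 : Set S2) (H : S1 → S2 → Prop) :
    pG step1 F1 step2 F2 H ≤ fsimLdelayF step1 F1 step2 F2 (pG step1 F1 step2 F2 H ⊔ H) :=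
  sSup_le fun _ hX => le_trans hX
    (fsimLdelayF_mono step1 F1 step2 F2 (sup_le_sup_right (le_pG hX) H))

/-- Soundness of the R-Invariant rule. -/
theorem stmt10 (step1 : S1 → E → S1 → Prop) (F1 : Set S1)
    (step2 : S2 → E → S2 → Prop) (F2 : Set S2)
    (H H' : S1 → S2 → Prop) (s1 : S1) (s2 : S2)
    (hmem : H' s1 s2)
    (hacc : ∀ s1' s2', H' s1' s2' → s1' ∈ F1)
    (hstep : ∀ s1' s2', H' s1' s2' →
      fsimRdelay step1 step2 F2
        ((H ⊔ H') ⊔ pG step1 F1 step2 F2 (H ⊔ H')) s1' s2') :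
    fsimRdelay step1 step2 F2 (H ⊔ pG step1 F1 step2 F2 H) s1 s2 := by
  have hsup : H' ⊔ pG step1 F1 step2 F2 (H ⊔ H') ≤ pG step1 F1 step2 F2 H := by
    refine le_pG (sup_le ?_ ?_)
    · refine le_trans (fun t1 t2 h => hstep t1 t2 h) (le_trans ?_ le_sup_left)
      refine fsimRdelay_mono step1 step2 F2 (le_of_eq ?_)
      rw [sup_assoc, sup_comm]
    · refine le_trans (pG_le_fsimLdelayF step1 F1 step2 F2 _)
        (fsimLdelayF_mono step1 F1 step2 F2 (le_of_eq ?_))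
      rw [sup_comm, sup_assoc, sup_comm]
  refine fsimRdelay_mono step1 step2 F2 ?_ s1 s2 (hstep s1 s2 hmem)
  rw [sup_assoc]
  exact sup_le_sup_left hsup H

end AFS
end

section
/- Strictness of the inclusion of delay simulation in double delay simulation: let E = {schedule, init, work, done} be a four-element event type. Let A1 have states {q0, q1, q2} with transitions q0 →schedule q1, q1 →init q2, q2 →work q2, q2 →done q0 and accepting set F1 = {q1}, and let A2 have states {r0, r1} with transitions r0 →done r1, r0 →e r0 for every e ≠ done, r1 →e r1 for every e, and accepting set F2 = {r1}. Then (q0, r0) ∉ fsimL_delay, but (q0, r0) ∈ fsim_2delay. -/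
namespace AFS

variable {E S S1 S2 : Type*}

/-- The `delay` operator: wait for finitely many steps, then pass to `X`. -/
def delay (step1 : S1 → E → S1 → Prop) (step2 : S2 → E → S2 → Prop)
    (X : S1 → S2 → Prop) : S1 → S2 → Prop :=
  lfp (fun Y => Match step1 step2 Y ⊔ X)

/-- Double delay simulation. -/
def fsim2delay (step1 : S1 → E → S1 → Prop) (F1 : Set S1)
    (step2 : S2 → E → S2 → Prop) (F2 : Set S2) : S1 → S2 → Prop :=
  delay step1 step2 (fsimLdelay step1 F1 step2 F2)

/-- Events for the scheduler example. -/
inductive Ev : Type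
  | schedule | init | work | done

/-- States of the left automaton. -/
inductive St1 : Type
  | q0 | q1 | q2

/-- Transitions of the left automaton. -/
inductive Step1 : St1 → Ev → St1 → Prop
  | sched : Step1 .q0 .schedule .q1
  | init : Step1 .q1 .init .q2
  | work : Step1 .q2 .work .q2
  | done : Step1 .q2 .done .q0

/-- States of the right automaton. -/
inductive St2 : Type
  | r0 | r1

/-- Transitions of the right automaton: `r0 →done r1`, `r0 →e r0` for `e ≠ done`,
`r1 →e r1` for every `e`. -/
inductive Step2 : St2 → Ev → St2 → Prop
  | done : Step2 .r0 .done .r1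
  | loop0 (e : Ev) : e ≠ .done → Step2 .r0 e .r0
  | loop1 (e : Ev) : Step2 .r1 e .r1

theorem le_gfp {α : Type*} [CompleteLattice α] {f : α → α} {a : α} (h : a ≤ f a) :
    a ≤ gfp f :=
  le_sSup h

theorem gfp_le_map {α : Type*} [CompleteLattice α] {f : α → α} (hf : Monotone f) :
    gfp f ≤ f (gfp f) :=
  sSup_le fun _ ha => le_trans ha (hf (le_sSup ha))

theorem lfp_le {α : Type*} [CompleteLattice α] {f : α → α} {a : α} (h : f a ≤ a) :
    lfp f ≤ a :=
  sInf_le h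

theorem map_lfp_le {α : Type*} [CompleteLattice α] {f : α → α} (hf : Monotone f) :
    f (lfp f) ≤ lfp f :=
  le_sInf fun _ ha => le_trans (hf (sInf_le ha)) ha

theorem lfp_mono {α : Type*} [CompleteLattice α] {f g : α → α} (h : f ≤ g) :
    lfp f ≤ lfp g :=
  sInf_le_sInf fun a ha => le_trans (h a) ha

theorem fsimRdelay_of_mem {step1 : S1 → E → S1 → Prop} {step2 : S2 → E → S2 → Prop}
    {F2 : Set S2} {X : S1 → S2 → Prop} {s1 : S1} {s2 : S2} (h2 : s2 ∈ F2)
    (hX : Match step1 step2 X s1 s2) : fsimRdelay step1 step2 F2 X s1 s2 := by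
  have hf : Monotone fun Y : S1 → S2 → Prop =>
      (fun s1 s2 => s2 ∈ F2 ∧ Match step1 step2 X s1 s2) ⊔ Match step1 step2 Y :=
    fun _ _ hY => sup_le_sup_left (Match_mono step1 step2 hY) _
  exact map_lfp_le hf s1 s2 (Or.inl ⟨h2, hX⟩)

theorem delay_of_Match {step1 : S1 → E → S1 → Prop} {step2 : S2 → E → S2 → Prop}
    {X : S1 → S2 → Prop} {s1 : S1} {s2 : S2}
    (h : Match step1 step2 (delay step1 step2 X) s1 s2) : delay step1 step2 X s1 s2 := by
  have hf : Monotone fun Y : S1 → S2 → Prop => Match step1 step2 Y ⊔ X :=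
    fun _ _ hY => sup_le_sup_right (Match_mono step1 step2 hY) _
  exact map_lfp_le hf s1 s2 (Or.inl h)

theorem le_delay (step1 : S1 → E → S1 → Prop) (step2 : S2 → E → S2 → Prop)
    (X : S1 → S2 → Prop) : X ≤ delay step1 step2 X :=
  le_sInf fun _ hY => le_trans le_sup_right hY

/-- The inductive part never relates anything to `r0`: every left state has a step
which keeps the right automaton in `r0`. -/
theorem fsimRdelay_right_eq_r1 {X : St1 → St2 → Prop} {s1 : St1} {s2 : St2}
    (h : fsimRdelay Step1 Step2 {St2.r1} X s1 s2) : s2 = .r1 := by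
  refine lfp_le (a := fun _ s2 => s2 = St2.r1) ?_ s1 s2 h
  rintro s1 s2 (⟨h, -⟩ | h)
  · exact h
  · have key : ∃ e s1', e ≠ Ev.done ∧ Step1 s1 e s1' := by
      cases s1
      · exact ⟨.schedule, _, nofun, .sched⟩
      · exact ⟨.init, _, nofun, .init⟩
      · exact ⟨.work, _, nofun, .work⟩
    obtain ⟨e, s1', he, hs⟩ := key
    obtain ⟨s2', hs2, rfl⟩ := h e s1' hs
    cases hs2
    · exact absurd rfl he
    · rfl

theorem fsimLdelay_q2_r0 : fsimLdelay Step1 {St1.q1} Step2 {St2.r1} .q2 .r0 := by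
  refine le_gfp (a := fun s1 s2 => s2 = St2.r1 ∨ s1 = St1.q2) ?_ _ _ (Or.inr rfl)
  rintro s1 (_ | _) h
  · obtain rfl : s1 = .q2 := h.resolve_left nofun
    refine Or.inr ⟨nofun, ?_⟩
    rintro _ _ (_ | _)
    · exact ⟨.r0, .loop0 _ nofun, Or.inr rfl⟩
    · exact ⟨.r1, .done, Or.inl rfl⟩
  · exact Or.inl (fsimRdelay_of_mem rfl fun e _ _ => ⟨.r1, .loop1 e, Or.inl rfl⟩)

theorem not_fsimLdelay_q1_r0 : ¬ fsimLdelay Step1 {St1.q1} Step2 {St2.r1} .q1 .r0 := by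
  intro h
  rcases gfp_le_map (fsimLdelayF_mono _ _ _ _) _ _ h with h | ⟨h, -⟩
  · cases fsimRdelay_right_eq_r1 h
  · exact h rfl

/-- `(q0, r0)` is not in the delay simulation, but it is in the double delay
simulation. -/
theorem stmt15 :
    ¬ fsimLdelay Step1 ({St1.q1} : Set St1) Step2 ({St2.r1} : Set St2) St1.q0 St2.r0 ∧
    fsim2delay Step1 ({St1.q1} : Set St1) Step2 ({St2.r1} : Set St2) St1.q0 St2.r0 := by
  refine ⟨fun h => ?_, ?_⟩
  · rcases gfp_le_map (fsimLdelayF_mono _ _ _ _) _ _ h with h | ⟨-, h⟩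
    · cases fsimRdelay_right_eq_r1 h
    · obtain ⟨_, hs, h⟩ := h _ _ .sched
      cases hs
      exact not_fsimLdelay_q1_r0 h
  · refine delay_of_Match ?_
    rintro _ _ ⟨⟩
    refine ⟨.r0, .loop0 _ nofun, delay_of_Match ?_⟩
    rintro _ _ ⟨⟩
    exact ⟨.r0, .loop0 _ nofun, le_delay _ _ _ _ _ fsimLdelay_q2_r0⟩

end AFS
end
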